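/- arXiv:2508.19100 — 5 statements merged into one kernel-verified Lean document; each statement's English description precedes it below -/
import Mathlib

section
/- Let f : ℝ^n → ℝ be differentiable and convex with L_s-Lipschitz gradient, let x* be a minimizer of f, and let (x_k) be gradient descent iterates x_{k+1} = x_k − α_k ∇f(x_k). Fix ε ∈ (0,1) and suppose ε/L_s ≤ α_k ≤ (2−ε)/L_s for all k. Then there exists a constant c₂ > 0 depending only on ε (not on f, L_s, n, or x_0) such that for all k ≥ 1, ‖∇f(x_k)‖ ≤ (L_s/c₂)·‖x_0 − x*‖/k. -/
open scoped RealInnerProductSpace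

theorem hasDerivAt_comp_add_smul_of_hasGradientAt
    {E : Type*} [NormedAddCommGroup E] [InnerProductSpace ℝ E] [CompleteSpace E]
    {f : E → ℝ} {f' : E → E} (hf : ∀ z, HasGradientAt f (f' z) z) (x v : E) (s : ℝ) :
    HasDerivAt (fun s : ℝ => f (x + s • v)) ⟪f' (x + s • v), v⟫ s := by
  have hline : HasDerivAt (fun s : ℝ => x + s • v) v s := by
    simpa using ((hasDerivAt_id s).smul_const v).const_add x
  simpa [Function.comp_def] using
    (hf (x + s • v)).hasFDerivAt.comp_hasDerivAt s hline

/-- First-order characterization of convexity. -/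
theorem ConvexOn.add_inner_le_of_hasGradientAt
    {E : Type*} [NormedAddCommGroup E] [InnerProductSpace ℝ E] [CompleteSpace E]
    {f : E → ℝ} {f' : E → E} (hc : ConvexOn ℝ Set.univ f)
    (hf : ∀ z, HasGradientAt f (f' z) z) (x y : E) :
    f x + ⟪f' x, y - x⟫ ≤ f y := by
  have hconv : ConvexOn ℝ Set.univ (fun s : ℝ => f (x + s • (y - x))) := by
    have h := hc.comp_affineMap (AffineMap.lineMap (k := ℝ) x y)
    simpa [Function.comp_def, AffineMap.lineMap_apply, add_comm] using h
  have hd := hasDerivAt_comp_add_smul_of_hasGradientAt hf x (y - x) 0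
  have h := hconv.le_slope_of_hasDerivAt (Set.mem_univ 0) (Set.mem_univ 1) zero_lt_one hd
  simp [slope_def_field] at h
  linarith

/-- The descent lemma. -/
theorem le_add_inner_add_of_lipschitz_gradient
    {E : Type*} [NormedAddCommGroup E] [InnerProductSpace ℝ E] [CompleteSpace E]
    {f : E → ℝ} {f' : E → E} (hf : ∀ z, HasGradientAt f (f' z) z) {L : ℝ}
    (hL : ∀ u v, ‖f' v - f' u‖ ≤ L * ‖v - u‖) (x y : E) :
    f y ≤ f x + ⟪f' x, y - x⟫ + L / 2 * ‖y - x‖ ^ 2 := by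
  set v := y - x with hv
  have hd : ∀ s : ℝ, HasDerivAt
      (fun s : ℝ => f (x + s • v) - s * ⟪f' x, v⟫ - L / 2 * ‖v‖ ^ 2 * s ^ 2)
      (⟪f' (x + s • v), v⟫ - ⟪f' x, v⟫ - L * ‖v‖ ^ 2 * s) s := by
    intro s
    have h := ((hasDerivAt_comp_add_smul_of_hasGradientAt hf x v s).sub
      ((hasDerivAt_id s).mul_const ⟪f' x, v⟫)).sub
      (((hasDerivAt_id s).pow 2).const_mul (L / 2 * ‖v‖ ^ 2))
    refine h.congr_deriv ?_
    simp
    ring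
  have hanti : AntitoneOn
      (fun s : ℝ => f (x + s • v) - s * ⟪f' x, v⟫ - L / 2 * ‖v‖ ^ 2 * s ^ 2)
      (Set.Icc 0 1) := by
    refine antitoneOn_of_deriv_nonpos (convex_Icc 0 1)
      (fun s _ => (hd s).continuousAt.continuousWithinAt)
      (fun s _ => (hd s).differentiableAt.differentiableWithinAt) ?_
    intro s hs
    rw [interior_Icc] at hs
    rw [(hd s).deriv, ← inner_sub_left]
    have h1 := real_inner_le_norm (f' (x + s • v) - f' x) v
    have h2 := hL x (x + s • v)
    rw [add_sub_cancel_left, norm_smul, Real.norm_of_nonneg hs.1.le] at h2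
    nlinarith [mul_le_mul_of_nonneg_right h2 (norm_nonneg v)]
  have h := hanti (Set.left_mem_Icc.2 zero_le_one) (Set.right_mem_Icc.2 zero_le_one) zero_le_one
  simp [hv] at h
  rw [← hv] at h
  linarith

/-- The smooth convex interpolation inequality. -/
theorem ConvexOn.add_inner_add_le_of_lipschitz_gradient
    {E : Type*} [NormedAddCommGroup E] [InnerProductSpace ℝ E] [CompleteSpace E]
    {f : E → ℝ} {f' : E → E} (hc : ConvexOn ℝ Set.univ f)
    (hf : ∀ z, HasGradientAt f (f' z) z) {L : ℝ} (hLpos : 0 < L)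
    (hL : ∀ u v, ‖f' v - f' u‖ ≤ L * ‖v - u‖) (x y : E) :
    f x + ⟪f' x, y - x⟫ + 1 / (2 * L) * ‖f' y - f' x‖ ^ 2 ≤ f y := by
  set w := f' y - f' x with hw
  have h1 := hc.add_inner_le_of_hasGradientAt hf x (y - L⁻¹ • w)
  have h2 := le_add_inner_add_of_lipschitz_gradient hf hL y (y - L⁻¹ • w)
  have e1 : y - L⁻¹ • w - x = (y - x) - L⁻¹ • w := by abel
  have e2 : y - L⁻¹ • w - y = -(L⁻¹ • w) := by abel
  rw [e1, inner_sub_right, real_inner_smul_right] at h1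
  rw [e2, inner_neg_right, real_inner_smul_right, norm_neg, norm_smul, mul_pow,
    Real.norm_of_nonneg (inv_pos.2 hLpos).le] at h2
  have e3 : ⟪f' y, w⟫ - ⟪f' x, w⟫ = ‖w‖ ^ 2 := by
    rw [← inner_sub_left, ← hw, real_inner_self_eq_norm_sq]
  have e4 : L / 2 * (L⁻¹ ^ 2 * ‖w‖ ^ 2) = L⁻¹ * ‖w‖ ^ 2 - 1 / (2 * L) * ‖w‖ ^ 2 := by
    field_simp
    ring
  have e5 : L⁻¹ * ⟪f' y, w⟫ - L⁻¹ * ⟪f' x, w⟫ = L⁻¹ * ‖w‖ ^ 2 := by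
    rw [← mul_sub, e3]
  linarith

/-- Cocoercivity of the gradient of a smooth convex function. -/
theorem ConvexOn.norm_sq_sub_le_mul_inner_of_lipschitz_gradient
    {E : Type*} [NormedAddCommGroup E] [InnerProductSpace ℝ E] [CompleteSpace E]
    {f : E → ℝ} {f' : E → E} (hc : ConvexOn ℝ Set.univ f)
    (hf : ∀ z, HasGradientAt f (f' z) z) {L : ℝ} (hLpos : 0 < L)
    (hL : ∀ u v, ‖f' v - f' u‖ ≤ L * ‖v - u‖) (x y : E) :
    ‖f' y - f' x‖ ^ 2 ≤ L * ⟪f' y - f' x, y - x⟫ := by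
  have h1 := hc.add_inner_add_le_of_lipschitz_gradient hf hLpos hL x y
  have h2 := hc.add_inner_add_le_of_lipschitz_gradient hf hLpos hL y x
  rw [norm_sub_rev (f' x), ← neg_sub y x, inner_neg_right] at h2
  rw [inner_sub_left]
  have h3 : L⁻¹ * ‖f' y - f' x‖ ^ 2 ≤ ⟪f' y, y - x⟫ - ⟪f' x, y - x⟫ := by
    have e : 1 / (2 * L) * ‖f' y - f' x‖ ^ 2 + 1 / (2 * L) * ‖f' y - f' x‖ ^ 2
        = L⁻¹ * ‖f' y - f' x‖ ^ 2 := by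
      field_simp
      ring
    linarith
  rwa [inv_mul_le_iff₀ hLpos] at h3

/-- A gradient step with stepsize at most `2 / L` does not increase the gradient norm. -/
theorem ConvexOn.norm_gradient_step_le
    {E : Type*} [NormedAddCommGroup E] [InnerProductSpace ℝ E] [CompleteSpace E]
    {f : E → ℝ} {f' : E → E} (hc : ConvexOn ℝ Set.univ f)
    (hf : ∀ z, HasGradientAt f (f' z) z) {L : ℝ} (hLpos : 0 < L)
    (hL : ∀ u v, ‖f' v - f' u‖ ≤ L * ‖v - u‖) {a : ℝ} (ha : 0 < a) (haL : L * a ≤ 2) (x : E) :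
    ‖f' (x - a • f' x)‖ ≤ ‖f' x‖ := by
  have h := hc.norm_sq_sub_le_mul_inner_of_lipschitz_gradient hf hLpos hL x (x - a • f' x)
  rw [sub_sub_cancel_left, inner_neg_right, real_inner_smul_right] at h
  set g := f' (x - a • f' x)
  have e := norm_sub_sq_real g (f' x)
  have e2 : ⟪g - f' x, f' x⟫ = ⟪g, f' x⟫ - ‖f' x‖ ^ 2 := by
    rw [inner_sub_left, real_inner_self_eq_norm_sq]
  rw [e2] at h
  have hpos : 0 < L * a := mul_pos hLpos ha
  have hneg : ⟪g, f' x⟫ - ‖f' x‖ ^ 2 ≤ 0 := by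
    by_contra! hp
    nlinarith [mul_pos hpos hp, sq_nonneg ‖g - f' x‖]
  refine (sq_le_sq₀ (norm_nonneg _) (norm_nonneg _)).1 ?_
  nlinarith [mul_nonneg (sub_nonneg.2 haL) (neg_nonneg.2 hneg)]

/-- Lyapunov bound from the recursions satisfied by the normalized squared distance `D`,
optimality gap `δ` and squared gradient norm `G` of gradient descent. -/
theorem mul_sq_mul_le_of_descent_recursions {ε : ℝ} (hε : 0 < ε) (hε1 : ε < 1)
    {D δ G t : ℕ → ℝ} (ht : ∀ k, ε ≤ t k ∧ t k ≤ 2 - ε)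
    (hD : ∀ k, 0 ≤ D k) (hδ : ∀ k, 0 ≤ δ k) (hG : ∀ k, 0 ≤ G k)
    (hDs : ∀ k, D (k + 1) ≤ D k - 2 * t k * δ k + t k * (t k - 1) * G k)
    (hδs : ∀ k, δ (k + 1) ≤ δ k - t k * (2 - t k) / 2 * G k)
    (hGs : ∀ k, G (k + 1) ≤ G k) (k : ℕ) :
    ε ^ 2 / 2 * k ^ 2 * G k ≤ D 0 + 2 / ε * δ 0 := by
  have hV : ∀ k : ℕ, D k + (2 / ε + 2 * ε * k) * δ k + ε ^ 2 / 2 * k ^ 2 * G k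
      ≤ D 0 + 2 / ε * δ 0 := by
    intro k
    induction k with
    | zero => simp
    | succ k ih =>
      refine le_trans ?_ ih
      obtain ⟨h1, h2⟩ := ht k
      have hk : (0 : ℝ) ≤ k := Nat.cast_nonneg k
      have ht0 : 0 ≤ t k := hε.le.trans h1
      have habs : t k * (t k - 1) * G k ≤ 2 / ε * (t k * (2 - t k) / 2 * G k) := by
        have e : 2 / ε * (t k * (2 - t k) / 2 * G k) = t k * ((2 - t k) / ε) * G k := by
          field_simp
        have h3 : 1 ≤ (2 - t k) / ε := by rw [le_div_iff₀ hε]; linarith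
        rw [e]
        gcongr
        · exact hG k
        · linarith
      have hstep : ε / 2 * G k ≤ t k * (2 - t k) / 2 * G k := by
        gcongr
        · exact hG k
        · nlinarith
      have hdec : ε / 2 * G k ≤ δ k - δ (k + 1) := by linarith [hδs k]
      have hA := mul_le_mul_of_nonneg_left (hδs k) (show 0 ≤ 2 / ε by positivity)
      have hB := mul_le_mul_of_nonneg_left hdec (show 0 ≤ 2 * ε * (k + 1) by positivity)
      have hC := mul_le_mul_of_nonneg_left (hGs k)
        (show 0 ≤ ε ^ 2 / 2 * ((k : ℝ) + 1) ^ 2 by positivity)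
      have hE := mul_le_mul_of_nonneg_right h1 (hδ k)
      have hF : 0 ≤ ε ^ 2 / 2 * G k := mul_nonneg (by positivity) (hG k)
      push_cast
      linarith [hDs k]
  have h0 : 0 ≤ (2 / ε + 2 * ε * k) * δ k := mul_nonneg (by positivity) (hδ k)
  linarith [hV k, hD k]

/-- `O(1/k)` convergence rate of gradient norms for gradient descent on an `Ls`-smooth
convex function with stepsizes `ε/Ls ≤ α_k ≤ (2-ε)/Ls`: there is a constant `c₂ > 0`
depending only on `ε` such that `‖∇f(x_k)‖ ≤ (Ls/c₂)‖x₀ - x*‖/k` for all `k ≥ 1`. -/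
theorem gd_gradient_norm_rate
    (ε : ℝ) (hε : ε ∈ Set.Ioo (0 : ℝ) 1) :
    ∃ c₂ > (0 : ℝ),
      ∀ (n : ℕ) (f : EuclideanSpace ℝ (Fin n) → ℝ)
        (f' : EuclideanSpace ℝ (Fin n) → EuclideanSpace ℝ (Fin n)),
        (∀ z, HasGradientAt f (f' z) z) →
        ConvexOn ℝ Set.univ f →
        ∀ Ls : ℝ, 0 < Ls →
        (∀ u v, ‖f' v - f' u‖ ≤ Ls * ‖v - u‖) →
        ∀ xs : EuclideanSpace ℝ (Fin n), (∀ z, f xs ≤ f z) →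
        ∀ α : ℕ → ℝ, (∀ k, ε / Ls ≤ α k ∧ α k ≤ (2 - ε) / Ls) →
        ∀ x : ℕ → EuclideanSpace ℝ (Fin n),
        (∀ k, x (k + 1) = x k - α k • f' (x k)) →
        ∀ k : ℕ, 1 ≤ k →
          ‖f' (x k)‖ ≤ (Ls / c₂) * ‖x 0 - xs‖ / k := by
  obtain ⟨hε0, hε1⟩ := hε
  refine ⟨ε ^ 2 / 2, by positivity, ?_⟩
  intro n f f' hf hc L hL hlip xs hmin α hα x hx k hk
  have hgs : f' xs = 0 := by
    have h := (show IsLocalMin f xs from Filter.Eventually.of_forall hmin).hasFDerivAt_eq_zero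
      (hf xs).hasFDerivAt
    simpa using h
  have ht : ∀ k, ε ≤ L * α k ∧ L * α k ≤ 2 - ε := fun k =>
    ⟨(div_le_iff₀' hL).1 (hα k).1, (le_div_iff₀' hL).1 (hα k).2⟩
  have hα0 : ∀ k, 0 < α k := fun k => (div_pos hε0 hL).trans_le (hα k).1
  have hgrad : ∀ k, ‖f' (x (k + 1))‖ ≤ ‖f' (x k)‖ := fun k => by
    rw [hx]
    exact hc.norm_gradient_step_le hf hL hlip (hα0 k) (by linarith [(ht k).2]) (x k)
  have hmain := mul_sq_mul_le_of_descent_recursions hε0 hε1 (D := fun k => ‖x k - xs‖ ^ 2)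
    (δ := fun k => (f (x k) - f xs) / L) (G := fun k => ‖f' (x k)‖ ^ 2 / L ^ 2)
    (t := fun k => L * α k) ht (fun k => by positivity)
    (fun k => div_nonneg (sub_nonneg.2 (hmin _)) hL.le) (fun k => by positivity)
    (fun k => by
      have h := hc.add_inner_add_le_of_lipschitz_gradient hf hL hlip (x k) xs
      rw [hgs, zero_sub, norm_neg, ← neg_sub (x k) xs, inner_neg_right] at h
      have e : x (k + 1) - xs = (x k - xs) - α k • f' (x k) := by rw [hx]; abel
      have h2 := mul_le_mul_of_nonneg_left h (show 0 ≤ 2 * α k by linarith [hα0 k])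
      rw [e, norm_sub_sq_real, real_inner_smul_right, norm_smul, mul_pow, Real.norm_eq_abs,
        sq_abs, real_inner_comm]
      have e2 : ‖x k - xs‖ ^ 2 - 2 * (L * α k) * ((f (x k) - f xs) / L)
          + L * α k * (L * α k - 1) * (‖f' (x k)‖ ^ 2 / L ^ 2)
          = ‖x k - xs‖ ^ 2 - 2 * α k * (f (x k) - f xs) + α k ^ 2 * ‖f' (x k)‖ ^ 2
            - 2 * α k * (1 / (2 * L) * ‖f' (x k)‖ ^ 2) := by
        field_simp
        ring
      rw [e2]
      linarith)
    (fun k => by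
      have h := le_add_inner_add_of_lipschitz_gradient hf hlip (x k) (x (k + 1))
      have e : x (k + 1) - x k = -(α k • f' (x k)) := by rw [hx]; abel
      rw [e, inner_neg_right, real_inner_smul_right, real_inner_self_eq_norm_sq, norm_neg,
        norm_smul, mul_pow, Real.norm_eq_abs, sq_abs] at h
      have e2 : (f (x k) - f xs) / L - L * α k * (2 - L * α k) / 2 * (‖f' (x k)‖ ^ 2 / L ^ 2)
          = (f (x k) - α k * ‖f' (x k)‖ ^ 2 + L / 2 * (α k ^ 2 * ‖f' (x k)‖ ^ 2) - f xs) / L := by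
        field_simp
        ring
      rw [e2]
      gcongr
      linarith)
    (fun k => by gcongr ?_ ^ 2 / _; exact hgrad k) k
  have hgap : (f (x 0) - f xs) / L ≤ ‖x 0 - xs‖ ^ 2 / 2 := by
    have h := le_add_inner_add_of_lipschitz_gradient hf hlip xs (x 0)
    rw [hgs, inner_zero_left] at h
    rw [div_le_iff₀ hL]
    linarith
  have hk0 : (0 : ℝ) < k := by exact_mod_cast hk
  have hbound : ε ^ 2 / 2 * k ^ 2 * (‖f' (x k)‖ ^ 2 / L ^ 2) ≤ 2 / ε * ‖x 0 - xs‖ ^ 2 := by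
    have h1 := mul_le_mul_of_nonneg_left hgap (show 0 ≤ 2 / ε by positivity)
    have h2 : ‖x 0 - xs‖ ^ 2 ≤ 1 / ε * ‖x 0 - xs‖ ^ 2 :=
      le_mul_of_one_le_left (sq_nonneg _) ((one_le_div hε0).2 hε1.le)
    have e1 : 2 / ε * (‖x 0 - xs‖ ^ 2 / 2) = 1 / ε * ‖x 0 - xs‖ ^ 2 := by ring
    have e2 : 2 / ε * ‖x 0 - xs‖ ^ 2 = 1 / ε * ‖x 0 - xs‖ ^ 2 + 1 / ε * ‖x 0 - xs‖ ^ 2 := by ring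
    linarith
  have hsq : (ε ^ 2 / 2 * k * (‖f' (x k)‖ / L)) ^ 2 ≤ ‖x 0 - xs‖ ^ 2 := by
    calc (ε ^ 2 / 2 * k * (‖f' (x k)‖ / L)) ^ 2
        = ε ^ 2 / 2 * (ε ^ 2 / 2 * k ^ 2 * (‖f' (x k)‖ ^ 2 / L ^ 2)) := by ring
      _ ≤ ε ^ 2 / 2 * (2 / ε * ‖x 0 - xs‖ ^ 2) := by gcongr
      _ = ε * ‖x 0 - xs‖ ^ 2 := by field_simp
      _ ≤ ‖x 0 - xs‖ ^ 2 := mul_le_of_le_one_left (sq_nonneg _) hε1.le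
  have hfin := (sq_le_sq₀ (by positivity) (norm_nonneg _)).1 hsq
  calc ‖f' (x k)‖ = L / (ε ^ 2 / 2) * (ε ^ 2 / 2 * k * (‖f' (x k)‖ / L)) / k := by
        field_simp
    _ ≤ L / (ε ^ 2 / 2) * ‖x 0 - xs‖ / k := by gcongr
end

section
/- Let f : ℝ^n → ℝ be convex and differentiable with a minimizer x* and optimal value f*. Let x_{k+1} = x_k − α_k ∇f(x_k) be a gradient descent step with α_k > 0 and ∇f(x_k) ≠ 0, and set L_k := ‖∇f(x_{k+1}) − ∇f(x_k)‖ / ‖x_{k+1} − x_k‖ and F_j := f(x_j) − f*. Then F_{k+1} ≤ F_k − (1 − L_k α_k)·α_k·‖∇f(x_k)‖². -/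
open scoped RealInnerProductSpace

/-- First-order condition for convexity: a convex function lies above its tangent hyperplanes. -/
theorem ConvexOn.inner_gradient_le_sub {E : Type*} [NormedAddCommGroup E]
    [InnerProductSpace ℝ E] [CompleteSpace E] {s : Set E} {f : E → ℝ} {g x y : E}
    (hf : ConvexOn ℝ s f) (hx : x ∈ s) (hy : y ∈ s) (hg : HasGradientAt f g x) :
    ⟪g, y - x⟫ ≤ f y - f x := by
  let l : ℝ →ᵃ[ℝ] E := AffineMap.lineMap x y
  have hl : HasDerivAt l (y - x) 0 := AffineMap.hasDerivAt_lineMap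
  have hconv : ConvexOn ℝ (l ⁻¹' s) (f ∘ l) := hf.comp_affineMap l
  have hderiv : HasDerivAt (f ∘ l) ⟪g, y - x⟫ 0 := by
    have hg' : HasFDerivAt f (InnerProductSpace.toDual ℝ E g) (l 0) := by
      simpa [l] using hg.hasFDerivAt
    simpa using hg'.comp_hasDerivAt 0 hl
  have h := hconv.le_slope_of_hasDerivAt (x := 0) (y := 1) (by simpa [l] using hx)
    (by simpa [l] using hy) one_pos hderiv
  simpa [slope_def_field, l] using h

/-- Function value decrease of a gradient descent step in terms of the local smoothness
estimate `L_k = ‖∇f(x_{k+1}) - ∇f(x_k)‖ / ‖x_{k+1} - x_k‖`: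
`F_{k+1} ≤ F_k - (1 - L_k α_k) α_k ‖∇f(x_k)‖²`. -/
theorem gd_step_local_decrease
    {n : ℕ} (f : EuclideanSpace ℝ (Fin n) → ℝ)
    (f' : EuclideanSpace ℝ (Fin n) → EuclideanSpace ℝ (Fin n))
    (hdiff : ∀ z, HasGradientAt f (f' z) z)
    (hconv : ConvexOn ℝ Set.univ f)
    (xs : EuclideanSpace ℝ (Fin n)) (hmin : ∀ z, f xs ≤ f z)
    (xk : EuclideanSpace ℝ (Fin n)) (α : ℝ) (hα : 0 < α)
    (hgrad : f' xk ≠ 0)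
    (xk1 : EuclideanSpace ℝ (Fin n)) (hstep : xk1 = xk - α • f' xk) :
    f xk1 - f xs ≤
      (f xk - f xs) -
        (1 - (‖f' xk1 - f' xk‖ / ‖xk1 - xk‖) * α) * α * ‖f' xk‖ ^ 2 := by
  subst hstep
  set g := f' xk
  set g₁ := f' (xk - α • g)
  have hg : ‖g‖ ≠ 0 := norm_ne_zero_iff.mpr hgrad
  have hsub : xk - α • g - xk = -(α • g) := by abel
  have htangent := hconv.inner_gradient_le_sub (Set.mem_univ _) (Set.mem_univ xk)
    (hdiff (xk - α • g))
  have hinner : ⟪g₁, xk - (xk - α • g)⟫ = α * (⟪g₁ - g, g⟫ + ‖g‖ ^ 2) := by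
    rw [sub_sub_cancel, inner_smul_right, inner_sub_left, real_inner_self_eq_norm_sq]
    ring
  have hcs : -(‖g₁ - g‖ * ‖g‖) ≤ ⟪g₁ - g, g⟫ :=
    (abs_le.mp (abs_real_inner_le_norm _ _)).1
  have hL : ‖g₁ - g‖ / ‖xk - α • g - xk‖ * α * α * ‖g‖ ^ 2 = α * (‖g₁ - g‖ * ‖g‖) := by
    rw [hsub, norm_neg, norm_smul, Real.norm_of_nonneg hα.le]
    field_simp
  have hmul := mul_le_mul_of_nonneg_left hcs hα.le
  linarith
end

section
/- Let f : ℝ^n → ℝ be convex and differentiable with a minimizer x* and optimal value f*. Let x_{k+1} = x_k − α_k ∇f(x_k) be a gradient descent step with α_k > 0 and ∇f(x_k) ≠ 0, and set L_k := ‖∇f(x_{k+1}) − ∇f(x_k)‖ / ‖x_{k+1} − x_k‖ and F_{k+1} := f(x_{k+1}) − f*. If L_k·α_k ∈ (0, 1/2), then ‖x_{k+1} − x*‖² − ‖x_k − x*‖² ≤ −2 α_k F_{k+1}. -/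
open scoped RealInnerProductSpace

/-- The first-order characterization of convexity: a convex function lies above its tangent
hyperplanes. -/
theorem ConvexOn.add_inner_gradient_le {E : Type*} [NormedAddCommGroup E]
    [InnerProductSpace ℝ E] [CompleteSpace E] {f : E → ℝ} {g x : E}
    (hf : ConvexOn ℝ Set.univ f) (hg : HasGradientAt f g x) (y : E) :
    f x + ⟪g, y - x⟫ ≤ f y := by
  have hconv : ConvexOn ℝ Set.univ (f ∘ AffineMap.lineMap (k := ℝ) x y) := by
    simpa using hf.comp_affineMap (AffineMap.lineMap (k := ℝ) x y)
  have hderiv : HasDerivAt (f ∘ AffineMap.lineMap (k := ℝ) x y) ⟪g, y - x⟫ 0 := by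
    have hg' : HasFDerivAt f (InnerProductSpace.toDual ℝ E g)
        (AffineMap.lineMap (k := ℝ) x y 0) := by
      simpa using hg.hasFDerivAt
    simpa using hg'.comp_hasDerivAt (0 : ℝ) AffineMap.hasDerivAt_lineMap
  have h := hconv.le_slope_of_hasDerivAt (Set.mem_univ 0) (Set.mem_univ 1) one_pos hderiv
  simp [slope_def_field] at h
  linarith

/-- If the stepsize satisfies `L_k α_k ∈ (0, 1/2)` with the local smoothness estimate
`L_k = ‖∇f(x_{k+1}) - ∇f(x_k)‖ / ‖x_{k+1} - x_k‖`, then a gradient descent step contracts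
the squared distance to a minimizer: `‖x_{k+1} - x*‖² - ‖x_k - x*‖² ≤ -2 α_k F_{k+1}`. -/
theorem gd_step_distance_decrease
    {n : ℕ} (f : EuclideanSpace ℝ (Fin n) → ℝ)
    (f' : EuclideanSpace ℝ (Fin n) → EuclideanSpace ℝ (Fin n))
    (hdiff : ∀ z, HasGradientAt f (f' z) z)
    (hconv : ConvexOn ℝ Set.univ f)
    (xs : EuclideanSpace ℝ (Fin n)) (hmin : ∀ z, f xs ≤ f z)
    (xk : EuclideanSpace ℝ (Fin n)) (α : ℝ) (hα : 0 < α)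
    (hgrad : f' xk ≠ 0)
    (xk1 : EuclideanSpace ℝ (Fin n)) (hstep : xk1 = xk - α • f' xk)
    (hLα : (‖f' xk1 - f' xk‖ / ‖xk1 - xk‖) * α ∈ Set.Ioo (0 : ℝ) (1 / 2)) :
    ‖xk1 - xs‖ ^ 2 - ‖xk - xs‖ ^ 2 ≤ -(2 * α * (f xk1 - f xs)) := by
  have hg : 0 < ‖f' xk‖ := norm_pos_iff.mpr hgrad
  have hstep_norm : ‖xk1 - xk‖ = α * ‖f' xk‖ := by
    rw [hstep, sub_sub_cancel_left, norm_neg, norm_smul, Real.norm_of_nonneg hα.le]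
  have hdiff_norm : ‖f' xk1 - f' xk‖ < ‖f' xk‖ / 2 := by
    have h := hLα.2
    rw [hstep_norm, div_mul_eq_mul_div, div_lt_iff₀ (by positivity)] at h
    nlinarith
  have hinner : ‖f' xk‖ ^ 2 / 2 ≤ ⟪f' xk1, f' xk⟫ := by
    have h := neg_le_of_abs_le (abs_real_inner_le_norm (f' xk1 - f' xk) (f' xk))
    rw [inner_sub_left, real_inner_self_eq_norm_sq] at h
    nlinarith
  have hxk : f xk - f xs ≤ ⟪f' xk, xk - xs⟫ := by
    have h := hconv.add_inner_gradient_le (hdiff xk) xs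
    rw [← neg_sub xk xs, inner_neg_right] at h
    linarith
  have hxk1 : f xk1 + α * ⟪f' xk1, f' xk⟫ ≤ f xk := by
    have h := hconv.add_inner_gradient_le (hdiff xk1) xk
    rwa [show xk - xk1 = α • f' xk by rw [hstep, sub_sub_cancel], real_inner_smul_right] at h
  have hexpand : ‖xk1 - xs‖ ^ 2
      = ‖xk - xs‖ ^ 2 - 2 * α * ⟪f' xk, xk - xs⟫ + α ^ 2 * ‖f' xk‖ ^ 2 := by
    rw [hstep, sub_right_comm, norm_sub_sq_real, real_inner_smul_right, norm_smul, mul_pow,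
      Real.norm_of_nonneg hα.le, real_inner_comm]
    ring
  have h₁ := mul_le_mul_of_nonneg_left hxk hα.le
  have h₂ := mul_le_mul_of_nonneg_left hxk1 hα.le
  have h₃ := mul_le_mul_of_nonneg_left hinner (sq_nonneg α)
  linarith
end

section
/- For every β ∈ (0,1) there exist n ∈ ℕ, a convex differentiable function f : ℝ^n → ℝ, and points x, y ∈ ℝ^n with y ≠ x, such that f(y) ≥ f(x) + ⟨∇f(x), y − x⟩ + β·L(y,x)·‖y − x‖², where L(y,x) := ‖∇f(y) − ∇f(x)‖ / ‖y − x‖ (equivalently, f(y) ≥ f(x) + ⟨∇f(x), y − x⟩ + β·‖∇f(y) − ∇f(x)‖·‖y − x‖). In other words, the upper bound f(y) ≤ f(x) + ⟨∇f(x), y − x⟩ + L(y,x)‖y − x‖² is tight over the class of convex differentiable functions. -/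
open scoped RealInnerProductSpace

/-- Tightness of the local-smoothness upper bound (Mishkin et al.): for every `β ∈ (0,1)`
there exist a convex differentiable function `f` and distinct points `x, y` such that
`f(y) ≥ f(x) + ⟨∇f(x), y - x⟩ + β L(y,x) ‖y - x‖²` where
`L(y,x) = ‖∇f(y) - ∇f(x)‖ / ‖y - x‖`. -/
theorem local_smoothness_bound_tight
    (β : ℝ) (hβ : β ∈ Set.Ioo (0 : ℝ) 1) :
    ∃ (n : ℕ) (f : EuclideanSpace ℝ (Fin n) → ℝ)
      (f' : EuclideanSpace ℝ (Fin n) → EuclideanSpace ℝ (Fin n)),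
      (∀ z, HasGradientAt f (f' z) z) ∧
      ConvexOn ℝ Set.univ f ∧
      ∃ x y : EuclideanSpace ℝ (Fin n), y ≠ x ∧
        f x + ⟪f' x, y - x⟫ +
          β * ((‖f' y - f' x‖ / ‖y - x‖) * ‖y - x‖ ^ 2) ≤ f y := by
  obtain ⟨hβ0, hβ1⟩ := hβ
  have hp : 1 < β⁻¹ := (one_lt_inv₀ hβ0).2 hβ1
  refine ⟨1, fun z => β * ‖z‖ ^ β⁻¹, fun z => ‖z‖ ^ (β⁻¹ - 2) • z, fun z => ?_, ?_,
    0, EuclideanSpace.single 0 1, ?_, ?_⟩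
  · rw [hasGradientAt_iff_hasFDerivAt]
    refine ((hasFDerivAt_norm_rpow z hp).const_mul β).congr_fderiv ?_
    ext w
    simp [← mul_assoc, hβ0.ne']
  · have hnorm : ConvexOn ℝ Set.univ (fun z : EuclideanSpace ℝ (Fin 1) => ‖z‖ ^ β⁻¹) := by
      refine ⟨convex_univ, fun x _ y _ a b ha hb hab => ?_⟩
      refine (Real.rpow_le_rpow (norm_nonneg _)
        (convexOn_univ_norm.2 (Set.mem_univ x) (Set.mem_univ y) ha hb hab) (by positivity)).trans ?_
      exact (convexOn_rpow hp.le).2 (norm_nonneg x) (norm_nonneg y) ha hb hab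
    exact hnorm.smul hβ0.le
  · intro h
    simpa using congrArg norm h
  · simp [Real.zero_rpow (inv_ne_zero hβ0.ne')]
end

section
/- Let f : ℝ^n → ℝ be convex, differentiable, and locally smooth, with a minimizer x* and optimal value f*. Let (x_k) be generated by x_{k+1} = x_k − α_k ∇f(x_k) with ∇f(x_k) ≠ 0 for all k, with α_k = γ_k/(a_k L_k) for all k ≥ 0, where γ_k ∈ (0,1), a_k ∈ (0, γ_k], α_{−1} > 0, and L_k := ‖∇f(x_{k+1}) − ∇f(x_k)‖/‖x_{k+1} − x_k‖. If in addition the growth-rate limit α_k ≤ (a_k/γ_k)·α_{k−1} holds for all k, then the function V^p_k := ‖x_k − x*‖² + (α_{k−1}/α_k)²·‖x_{k+1} − x_k‖² is nonincreasing in k; in particular V^p_{k+1} ≤ V^p_k − 2 α_k (f(x_{k+1}) − f*) for all k. -/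
open scoped RealInnerProductSpace

/-- One gradient step with a stepsize controlled by the local variation of the gradient. -/
theorem ConvexOn.gradient_step_lyapunov {E : Type*} [NormedAddCommGroup E]
    [InnerProductSpace ℝ E] [CompleteSpace E] {f : E → ℝ} {x y g h : E} {α β : ℝ}
    (hf : ConvexOn ℝ Set.univ f) (hg : HasGradientAt f g x) (hh : HasGradientAt f h y)
    (hy : y = x - α • g) (hα : 0 ≤ α) (hβ : α * ‖h - g‖ ≤ β * ‖g‖) (z : E) :
    ‖y - z‖ ^ 2 + α ^ 2 * ‖h‖ ^ 2 ≤
      ‖x - z‖ ^ 2 + β ^ 2 * ‖g‖ ^ 2 - 2 * α * (f y - f z) := by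
  have hxz := hf.add_inner_gradient_le hg z
  have hyx := hf.add_inner_gradient_le hh x
  have e1 : x - y = α • g := by rw [hy]; abel
  have e2 : y - z = (x - z) - α • g := by rw [hy]; abel
  have e3 : ⟪g, z - x⟫ = -⟪x - z, g⟫ := by
    rw [real_inner_comm, ← neg_sub x z, inner_neg_left]
  rw [e1, real_inner_smul_right] at hyx
  rw [e3] at hxz
  have hn : ‖y - z‖ ^ 2 = ‖x - z‖ ^ 2 - 2 * (α * ⟪x - z, g⟫) + α ^ 2 * ‖g‖ ^ 2 := by
    rw [e2, norm_sub_sq_real, real_inner_smul_right, norm_smul, mul_pow, Real.norm_eq_abs, sq_abs]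
  have hd := norm_sub_sq_real h g
  have hsq : (α * ‖h - g‖) ^ 2 ≤ (β * ‖g‖) ^ 2 := pow_le_pow_left₀ (by positivity) hβ 2
  rw [mul_pow, mul_pow, hd] at hsq
  have hmul := mul_le_mul_of_nonneg_left (add_le_add hxz hyx) hα
  rw [hn]
  linarith

/-- Robust convergence under the perturbed stepsize law `α_k = γ_k/(a_k L_k)` together
with the growth-rate limit `α_k ≤ (a_k/γ_k) α_{k-1}`: the Lyapunov function
`V^p_k = ‖x_k - x*‖² + (α_{k-1}/α_k)²‖x_{k+1} - x_k‖²` is nonincreasing, and in fact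
`V^p_{k+1} ≤ V^p_k - 2 α_k F_{k+1}`. Indexing convention: the paper's
`α_{k-1}, γ_{k-1}, a_{k-1}` (including `α_{-1}`) are `α k, γ k, a k` here. -/
theorem gd_perturbed_lyapunov_nonincreasing
    {n : ℕ} (f : EuclideanSpace ℝ (Fin n) → ℝ)
    (f' : EuclideanSpace ℝ (Fin n) → EuclideanSpace ℝ (Fin n))
    (hdiff : ∀ z, HasGradientAt f (f' z) z)
    (hconv : ConvexOn ℝ Set.univ f)
    (hloc : ∀ D : Set (EuclideanSpace ℝ (Fin n)), Convex ℝ D → IsCompact D →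
      ∃ L > (0 : ℝ), ∀ u ∈ D, ∀ v ∈ D, ‖f' v - f' u‖ ≤ L * ‖v - u‖)
    (xs : EuclideanSpace ℝ (Fin n)) (hmin : ∀ z, f xs ≤ f z)
    (x : ℕ → EuclideanSpace ℝ (Fin n)) (α γ a : ℕ → ℝ)
    (hγ : ∀ k, γ (k + 1) ∈ Set.Ioo (0 : ℝ) 1)
    (ha : ∀ k, a (k + 1) ∈ Set.Ioc (0 : ℝ) (γ (k + 1)))
    (hα0 : 0 < α 0)
    (hgrad : ∀ k, f' (x k) ≠ 0)
    (hstep : ∀ k, x (k + 1) = x k - α (k + 1) • f' (x k))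
    (hα : ∀ k, α (k + 1) =
      γ (k + 1) / (a (k + 1) * (‖f' (x (k + 1)) - f' (x k)‖ / ‖x (k + 1) - x k‖)))
    (hgrowth : ∀ k, α (k + 1) ≤ (a (k + 1) / γ (k + 1)) * α k) :
    Antitone (fun k : ℕ =>
        ‖x k - xs‖ ^ 2 + (α k / α (k + 1)) ^ 2 * ‖x (k + 1) - x k‖ ^ 2) ∧
    ∀ k : ℕ,
      ‖x (k + 1) - xs‖ ^ 2 + (α (k + 1) / α (k + 2)) ^ 2 * ‖x (k + 2) - x (k + 1)‖ ^ 2 ≤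
        (‖x k - xs‖ ^ 2 + (α k / α (k + 1)) ^ 2 * ‖x (k + 1) - x k‖ ^ 2) -
          2 * α (k + 1) * (f (x (k + 1)) - f xs) := by
  have hα_nonneg (k : ℕ) : 0 ≤ α k := by
    cases k with
    | zero => exact hα0.le
    | succ k =>
      rw [hα k]
      have := (hγ k).1
      have := (ha k).1
      positivity
  have hnorm (k : ℕ) : ‖x (k + 1) - x k‖ = α (k + 1) * ‖f' (x k)‖ := by
    rw [hstep k, sub_sub_cancel_left, norm_neg, norm_smul, Real.norm_of_nonneg (hα_nonneg _)]
  have hterm (k : ℕ) (h : α (k + 1) ≠ 0) :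
      (α k / α (k + 1)) ^ 2 * ‖x (k + 1) - x k‖ ^ 2 = α k ^ 2 * ‖f' (x k)‖ ^ 2 := by
    rw [hnorm k]
    field_simp
  have hterm_le (k : ℕ) :
      (α k / α (k + 1)) ^ 2 * ‖x (k + 1) - x k‖ ^ 2 ≤ α k ^ 2 * ‖f' (x k)‖ ^ 2 := by
    by_cases h : α (k + 1) = 0
    · rw [h, div_zero, zero_pow two_ne_zero, zero_mul]
      positivity
    · exact (hterm k h).le
  have hvar (k : ℕ) : α (k + 1) * ‖f' (x (k + 1)) - f' (x k)‖ ≤ α k * ‖f' (x k)‖ := by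
    by_cases h : α (k + 1) = 0
    · rw [h, zero_mul]
      exact mul_nonneg (hα_nonneg k) (norm_nonneg _)
    have hγk := (hγ k).1
    have hak := (ha k).1
    have hgk : 0 < ‖f' (x k)‖ := norm_pos_iff.2 (hgrad k)
    have hL := hα k
    rw [hnorm k] at hL
    have hΔ : ‖f' (x (k + 1)) - f' (x k)‖ ≠ 0 := by
      intro h0
      rw [h0, zero_div, mul_zero, div_zero] at hL
      exact h hL
    have hΔ_eq : a (k + 1) * ‖f' (x (k + 1)) - f' (x k)‖ = γ (k + 1) * ‖f' (x k)‖ := by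
      field_simp at hL
      linarith
    have hgr : γ (k + 1) * α (k + 1) ≤ a (k + 1) * α k := by
      have := hgrowth k
      rw [div_mul_eq_mul_div, le_div_iff₀ hγk] at this
      linarith
    refine le_of_mul_le_mul_left ?_ hak
    calc a (k + 1) * (α (k + 1) * ‖f' (x (k + 1)) - f' (x k)‖)
        = γ (k + 1) * α (k + 1) * ‖f' (x k)‖ := by rw [mul_left_comm, hΔ_eq]; ring
      _ ≤ a (k + 1) * α k * ‖f' (x k)‖ := mul_le_mul_of_nonneg_right hgr hgk.le
      _ = a (k + 1) * (α k * ‖f' (x k)‖) := mul_assoc _ _ _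
  have hdescent (k : ℕ) :
      ‖x (k + 1) - xs‖ ^ 2 + (α (k + 1) / α (k + 2)) ^ 2 * ‖x (k + 2) - x (k + 1)‖ ^ 2 ≤
        (‖x k - xs‖ ^ 2 + (α k / α (k + 1)) ^ 2 * ‖x (k + 1) - x k‖ ^ 2) -
          2 * α (k + 1) * (f (x (k + 1)) - f xs) := by
    by_cases h : α (k + 1) = 0
    · have hx : x (k + 1) = x k := by rw [hstep k, h, zero_smul, sub_zero]
      simp [h, hx]
    · have hle := hterm_le (k + 1)
      have hly := hconv.gradient_step_lyapunov (hdiff (x k)) (hdiff (x (k + 1))) (hstep k)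
        (hα_nonneg (k + 1)) (hvar k) xs
      rw [hterm k h]
      linarith
  refine ⟨antitone_nat_of_succ_le fun k => (hdescent k).trans ?_, hdescent⟩
  exact sub_le_self _ (mul_nonneg (mul_nonneg zero_le_two (hα_nonneg _))
    (sub_nonneg.2 (hmin _)))
end
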